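/- (Two-sided test: type II error control, finite-horizon form.) Fix an adaptive measurement scheme with horizon t, disjoint sets S₀ and S₁ of density matrices on ℂ^d, null and alternative MLE maps ρ̂₀^s and ρ̂₁^s for all 0 ≤ s ≤ t, and assume Tr(ρ^{⊗n_i} M^i(h)_x) > 0 for every ρ ∈ S₀ ∪ S₁, round i, history h, and outcome x. Let Λ₀^s and Λ₁^s be the associated split likelihood ratio and reversed split likelihood ratio, and fix ε₀, ε₁ ∈ (0,1). For x ∈ X^t, say the two-sided test accepts H₀ on x if there exists s ≤ t such that Λ₁^s(x) ≥ 1/ε₁ while Λ₀^r(x) < 1/ε₀ and Λ₁^r(x) < 1/ε₁ for all r < s. Then for every ρ ∈ S₁, the acceptance probability is at most ε₁: ∑_{x ∈ X^t : the test accepts H₀ on x} P_ρ(x) ≤ ε₁. -/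

import Mathlib

open Matrix BigOperators
open scoped ComplexOrder

noncomputable section

/-- A density matrix on `ℂ^d`: positive semidefinite with trace 1. -/
def IsDensityMatrix {d : ℕ} (ρ : Matrix (Fin d) (Fin d) ℂ) : Prop :=
  ρ.PosSemidef ∧ ρ.trace = 1

/-- A POVM with finite outcome set `X`: positive semidefinite effects summing to the identity. -/
def IsPOVM {m : Type*} [Fintype m] [DecidableEq m] {X : Type*} [Fintype X]
    (M : X → Matrix m m ℂ) : Prop :=
  (∀ x, (M x).PosSemidef) ∧ ∑ x, M x = 1

/-- The `n`-fold tensor power of a `d × d` matrix, indexed by tuples in `Fin n → Fin d`,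
with entries `(ρ^{⊗n})_{x,y} = ∏ i, ρ (x i) (y i)`. -/
def tensorPow {d : ℕ} (ρ : Matrix (Fin d) (Fin d) ℂ) (n : ℕ) :
    Matrix (Fin n → Fin d) (Fin n → Fin d) ℂ :=
  fun x y => ∏ i, ρ (x i) (y i)

/-- Born probability `Tr(ρ M)` as the associated (nonnegative) real number. -/
def bornProb {m : Type*} [Fintype m] (ρ M : Matrix m m ℂ) : ℝ :=
  ((ρ * M).trace).re

/-- An adaptive measurement scheme with horizon `t`: at round `i` (0-based), given a
history `h ∈ X^i`, it measures `n i ≥ 1` fresh copies with the POVM `M i h`. -/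
structure AdaptiveScheme (d : ℕ) (X : Type*) [Fintype X] (t : ℕ) where
  n : Fin t → ℕ
  hn : ∀ i, 1 ≤ n i
  M : (i : Fin t) → (Fin i → X) → X →
        Matrix (Fin (n i) → Fin d) (Fin (n i) → Fin d) ℂ
  hM : ∀ i h, IsPOVM (M i h)

/-- The history (first `i` outcomes) of an outcome sequence `x`. -/
def hist {X : Type*} {t : ℕ} (x : Fin t → X) (i : Fin t) : Fin i → X :=
  fun j => x ⟨j, j.isLt.trans i.isLt⟩

/-- Probability of observing the outcome sequence `x` under state `ρ`. -/
def seqProb {d t : ℕ} {X : Type*} [Fintype X] (S : AdaptiveScheme d X t)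
    (ρ : Matrix (Fin d) (Fin d) ℂ) (x : Fin t → X) : ℝ :=
  ∏ i, bornProb (tensorPow ρ (S.n i)) (S.M i (hist x i) (x i))

/-- Likelihood of the first `s` outcomes of a history `h ∈ X^s` under state `ρ`:
`∏_{i=1}^{s} Tr(ρ^{⊗ n_i} M^i(h_1,…,h_{i-1})_{h_i})` (rounds beyond the horizon contribute 1). -/
def likOnHist {d t : ℕ} {X : Type*} [Fintype X] (S : AdaptiveScheme d X t)
    (ρ : Matrix (Fin d) (Fin d) ℂ) (s : ℕ) (h : Fin s → X) : ℝ :=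
  ∏ i : Fin t, if hi : (i : ℕ) < s then
    bornProb (tensorPow ρ (S.n i))
      (S.M i (fun j => h ⟨j, j.isLt.trans hi⟩) (h ⟨i, hi⟩))
  else 1

/-- An MLE map for the class `S₀`: at each time `s ≤ t` and history `h ∈ X^s`, it returns a
state of `S₀` maximizing the likelihood of `h` over `S₀`. -/
def IsMLEMap {d t : ℕ} {X : Type*} [Fintype X] (S : AdaptiveScheme d X t)
    (S₀ : Set (Matrix (Fin d) (Fin d) ℂ))
    (est : (s : ℕ) → (Fin s → X) → Matrix (Fin d) (Fin d) ℂ) : Prop :=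
  ∀ s : ℕ, s ≤ t → ∀ h : Fin s → X,
    est s h ∈ S₀ ∧ ∀ ρ' ∈ S₀, likOnHist S ρ' s h ≤ likOnHist S (est s h) s h

/-- The split likelihood ratio at time `s ≤ t`:
`Λ₀^s(x) = ∏_{i=1}^{s} Tr((ρ̂₁^{i-1}(x_{<i}))^{⊗n_i} M^i_{x_i}) / Tr((ρ̂₀^{s}(x_{≤s}))^{⊗n_i} M^i_{x_i})`,
with non-anticipating alternative MLEs in the numerator and the time-`s` null MLE in the
denominator. -/
def slr₀ {d t : ℕ} {X : Type*} [Fintype X] (S : AdaptiveScheme d X t)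
    (est₀ est₁ : (s : ℕ) → (Fin s → X) → Matrix (Fin d) (Fin d) ℂ)
    (x : Fin t → X) (s : ℕ) (hs : s ≤ t) : ℝ :=
  ∏ i : Fin t, if (i : ℕ) < s then
    bornProb (tensorPow (est₁ i (hist x i)) (S.n i)) (S.M i (hist x i) (x i)) /
      bornProb (tensorPow (est₀ s (fun j => x (Fin.castLE hs j))) (S.n i))
        (S.M i (hist x i) (x i))
  else 1

/-- The reversed split likelihood ratio at time `s ≤ t`, exchanging the roles of the null and
alternative hypotheses:
`Λ₁^s(x) = ∏_{i=1}^{s} Tr((ρ̂₀^{i-1}(x_{<i}))^{⊗n_i} M^i_{x_i}) / Tr((ρ̂₁^{s}(x_{≤s}))^{⊗n_i} M^i_{x_i})`. -/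
def slr₁ {d t : ℕ} {X : Type*} [Fintype X] (S : AdaptiveScheme d X t)
    (est₀ est₁ : (s : ℕ) → (Fin s → X) → Matrix (Fin d) (Fin d) ℂ)
    (x : Fin t → X) (s : ℕ) (hs : s ≤ t) : ℝ :=
  ∏ i : Fin t, if (i : ℕ) < s then
    bornProb (tensorPow (est₀ i (hist x i)) (S.n i)) (S.M i (hist x i) (x i)) /
      bornProb (tensorPow (est₁ s (fun j => x (Fin.castLE hs j))) (S.n i))
        (S.M i (hist x i) (x i))
  else 1

/-- The two-sided QSUT accepts `H₀` on `x`: at some time `s ≤ t` the reversed split likelihood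
ratio crosses `1/ε₁`, while at all earlier times neither process had crossed its threshold. -/
def AcceptsNull {d t : ℕ} {X : Type*} [Fintype X] (S : AdaptiveScheme d X t)
    (est₀ est₁ : (s : ℕ) → (Fin s → X) → Matrix (Fin d) (Fin d) ℂ)
    (ε₀ ε₁ : ℝ) (x : Fin t → X) : Prop :=
  ∃ s : ℕ, ∃ hs : s ≤ t, 1 / ε₁ ≤ slr₁ S est₀ est₁ x s hs ∧
    ∀ r : ℕ, ∀ hr : r < s,
      slr₀ S est₀ est₁ x r (le_of_lt (lt_of_lt_of_le hr hs)) < 1 / ε₀ ∧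
      slr₁ S est₀ est₁ x r (le_of_lt (lt_of_lt_of_le hr hs)) < 1 / ε₁

theorem sum_prod_hist_eq_one {X : Type*} [Fintype X] {t : ℕ}
    (w : (i : Fin t) → (Fin i → X) → X → ℝ) (hw : ∀ i h, ∑ x, w i h x = 1) :
    ∑ x : Fin t → X, ∏ i, w i (hist x i) (x i) = 1 := by
  induction t with
  | zero => simp
  | succ t ih =>
    rw [← (Fin.snocEquiv fun _ : Fin (t + 1) => X).sum_comp, Fintype.sum_prod_type_right]
    have key : ∀ (y : Fin t → X) (a : X),
        ∏ i, w i (hist (Fin.snocEquiv (fun _ : Fin (t + 1) => X) (a, y)) i)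
          (Fin.snocEquiv (fun _ : Fin (t + 1) => X) (a, y) i) =
        (∏ i : Fin t, w i.castSucc (hist y i) (y i)) * w (Fin.last t) y a := by
      intro y a
      have hsnoc : ∀ j : Fin t,
          Fin.snocEquiv (fun _ : Fin (t + 1) => X) (a, y) j.castSucc = y j :=
        fun j => Fin.snoc_castSucc (α := fun _ => X) a y j
      have hlast : Fin.snocEquiv (fun _ : Fin (t + 1) => X) (a, y) (Fin.last t) = a :=
        Fin.snoc_last (α := fun _ => X) a y
      rw [Fin.prod_univ_castSucc]
      congr 1
      · refine Finset.prod_congr rfl fun i _ => ?_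
        rw [hsnoc]
        congr 1
        funext j
        exact hsnoc ⟨j, j.isLt.trans i.isLt⟩
      · rw [hlast]
        congr 1
        funext j
        exact hsnoc j
    simp only [key, ← Finset.mul_sum, hw, mul_one]
    exact ih (fun i => w i.castSucc) fun i h => hw i.castSucc h

theorem trace_tensorPow {d : ℕ} (ρ : Matrix (Fin d) (Fin d) ℂ) (n : ℕ) :
    (tensorPow ρ n).trace = ρ.trace ^ n := by
  exact (Fintype.sum_pow (fun j => ρ j j) n).symm

theorem sum_bornProb_eq_one {d n : ℕ} {X : Type*} [Fintype X]
    {ρ : Matrix (Fin d) (Fin d) ℂ} (hρ : ρ.trace = 1)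
    {M : X → Matrix (Fin n → Fin d) (Fin n → Fin d) ℂ} (hM : IsPOVM M) :
    ∑ x, bornProb (tensorPow ρ n) (M x) = 1 := by
  simp only [bornProb]
  rw [← Complex.re_sum, ← Matrix.trace_sum, ← Matrix.mul_sum, hM.2, Matrix.mul_one,
    trace_tensorPow, hρ]
  simp

theorem slr₁_congr {d t : ℕ} {X : Type*} [Fintype X] (S : AdaptiveScheme d X t)
    (est₀ est₁ : (s : ℕ) → (Fin s → X) → Matrix (Fin d) (Fin d) ℂ)
    {x y : Fin t → X} {s : ℕ} (hs : s ≤ t) (hxy : ∀ j : Fin t, (j : ℕ) < s → x j = y j) :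
    slr₁ S est₀ est₁ x s hs = slr₁ S est₀ est₁ y s hs := by
  unfold slr₁
  refine Finset.prod_congr rfl fun i _ => ?_
  split_ifs with hi
  · have hh : hist x i = hist y i := funext fun j => hxy _ (j.isLt.trans hi)
    have hc : (fun j => x (Fin.castLE hs j)) = fun j => y (Fin.castLE hs j) :=
      funext fun j => hxy _ j.isLt
    rw [hh, hc, hxy i hi]
  · rfl

theorem slr₁_eq_div {d t : ℕ} {X : Type*} [Fintype X] (S : AdaptiveScheme d X t)
    (est₀ est₁ : (s : ℕ) → (Fin s → X) → Matrix (Fin d) (Fin d) ℂ)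
    (x : Fin t → X) (s : ℕ) (hs : s ≤ t) :
    slr₁ S est₀ est₁ x s hs =
      (∏ i : Fin t, if (i : ℕ) < s then
        bornProb (tensorPow (est₀ i (hist x i)) (S.n i)) (S.M i (hist x i) (x i)) else 1) /
      likOnHist S (est₁ s fun j => x (Fin.castLE hs j)) s fun j => x (Fin.castLE hs j) := by
  unfold slr₁ likOnHist
  rw [← Finset.prod_div_distrib]
  refine Finset.prod_congr rfl fun i _ => ?_
  split_ifs with hi
  · rfl
  · simp

open Classical in
/-- two-sided test, type II error control (finite-horizon form) — under any
alternative state, the probability that the two-sided test accepts `H₀` is at most `ε₁`. -/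
theorem two_sided_typeII_error_control {d t : ℕ} {X : Type*} [Fintype X]
    (ht : 1 ≤ t) (S : AdaptiveScheme d X t)
    (S₀ S₁ : Set (Matrix (Fin d) (Fin d) ℂ)) (hdisj : Disjoint S₀ S₁)
    (hS₀ : ∀ ρ' ∈ S₀, IsDensityMatrix ρ') (hS₁ : ∀ ρ' ∈ S₁, IsDensityMatrix ρ')
    (est₀ est₁ : (s : ℕ) → (Fin s → X) → Matrix (Fin d) (Fin d) ℂ)
    (h₀ : IsMLEMap S S₀ est₀) (h₁ : IsMLEMap S S₁ est₁)
    (hpos : ∀ ρ' ∈ S₀ ∪ S₁, ∀ (i : Fin t) (h : Fin i → X) (x : X),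
      0 < bornProb (tensorPow ρ' (S.n i)) (S.M i h x))
    (ε₀ ε₁ : ℝ) (hε₀ : ε₀ ∈ Set.Ioo (0 : ℝ) 1) (hε₁ : ε₁ ∈ Set.Ioo (0 : ℝ) 1)
    (ρ : Matrix (Fin d) (Fin d) ℂ) (hρ : ρ ∈ S₁) :
    ∑ x : Fin t → X,
      (if AcceptsNull S est₀ est₁ ε₀ ε₁ x then seqProb S ρ x else 0) ≤ ε₁ := by
  classical
  obtain ⟨hε, -⟩ := hε₁
  have hpρ : ∀ i h x, 0 < bornProb (tensorPow ρ (S.n i)) (S.M i h x) := hpos ρ (Or.inr hρ)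
  have hp₀ : ∀ (i : Fin t) h x, 0 < bornProb (tensorPow (est₀ i h) (S.n i)) (S.M i h x) :=
    fun i h x => hpos _ (Or.inl (h₀ i i.isLt.le h).1) i h x
  let C : (i : Fin t) → (Fin i → X) → Prop := fun i h =>
    ∀ y : Fin t → X, hist y i = h → ∀ (r : ℕ) (hr : r ≤ i),
      slr₁ S est₀ est₁ y r (hr.trans i.isLt.le) < 1 / ε₁
  -- The estimator is used until the threshold is crossed, and `ρ` afterwards.
  let w : (i : Fin t) → (Fin i → X) → X → ℝ := fun i h a =>
    bornProb (tensorPow (if C i h then est₀ i h else ρ) (S.n i)) (S.M i h a)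
  have hw : ∀ i h, ∑ a, w i h a = 1 := by
    intro i h
    refine sum_bornProb_eq_one ?_ (S.hM i h)
    split_ifs
    · exact (hS₀ _ (h₀ i i.isLt.le h).1).2
    · exact (hS₁ ρ hρ).2
  have hwpos : ∀ i h a, 0 < w i h a := by
    intro i h a
    by_cases hc : C i h
    · simpa only [w, if_pos hc] using hp₀ i h a
    · simpa only [w, if_neg hc] using hpρ i h a
  suffices hx : ∀ x : Fin t → X,
      (if AcceptsNull S est₀ est₁ ε₀ ε₁ x then seqProb S ρ x else 0) ≤
        ε₁ * ∏ i, w i (hist x i) (x i) by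
    calc _ ≤ ∑ x : Fin t → X, ε₁ * ∏ i, w i (hist x i) (x i) :=
          Finset.sum_le_sum fun x _ => hx x
      _ = ε₁ := by rw [← Finset.mul_sum, sum_prod_hist_eq_one w hw, mul_one]
  intro x
  split_ifs with hacc
  swap
  · exact mul_nonneg hε.le (Finset.prod_nonneg fun i _ => (hwpos i _ _).le)
  obtain ⟨s, hs, hcross, hbefore⟩ := hacc
  have hC : ∀ i : Fin t, C i (hist x i) ↔ (i : ℕ) < s := by
    intro i
    constructor
    · intro hc
      by_contra hi
      exact absurd (hc x rfl s (not_lt.mp hi)) (not_lt.mpr hcross)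
    · intro hi y hy r hr
      rw [slr₁_congr S est₀ est₁ (y := x) _ fun j hj =>
        congrFun hy ⟨j, hj.trans_le hr⟩]
      exact (hbefore r (hr.trans_lt hi)).2
  set h : Fin s → X := fun j => x (Fin.castLE hs j)
  have hlik : ∀ ρ' ∈ S₁, 0 < likOnHist S ρ' s h := by
    intro ρ' hρ'
    refine Finset.prod_pos fun i _ => ?_
    split_ifs
    · exact hpos ρ' (Or.inr hρ') _ _ _
    · exact one_pos
  obtain ⟨hmem, hmax⟩ := h₁ s hs h
  rw [slr₁_eq_div, div_le_div_iff₀ hε (hlik _ hmem), one_mul] at hcross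
  have hle := (hmax ρ hρ).trans hcross
  have hseq : seqProb S ρ x = likOnHist S ρ s h *
      ∏ i : Fin t, if (i : ℕ) < s then 1 else
        bornProb (tensorPow ρ (S.n i)) (S.M i (hist x i) (x i)) := by
    unfold seqProb likOnHist
    rw [← Finset.prod_mul_distrib]
    refine Finset.prod_congr rfl fun i _ => ?_
    split_ifs with hi
    · rw [mul_one]; rfl
    · rw [one_mul]
  have hwprod : ∏ i, w i (hist x i) (x i) =
      (∏ i : Fin t, if (i : ℕ) < s then
        bornProb (tensorPow (est₀ i (hist x i)) (S.n i)) (S.M i (hist x i) (x i)) else 1) *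
      ∏ i : Fin t, if (i : ℕ) < s then 1 else
        bornProb (tensorPow ρ (S.n i)) (S.M i (hist x i) (x i)) := by
    rw [← Finset.prod_mul_distrib]
    refine Finset.prod_congr rfl fun i _ => ?_
    simp only [w, hC]
    split_ifs <;> simp
  rw [hseq, hwprod, ← mul_assoc, mul_comm ε₁]
  refine mul_le_mul_of_nonneg_right hle (Finset.prod_nonneg fun i _ => ?_)
  split_ifs
  · exact zero_le_one
  · exact (hpρ i _ _).le
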